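/- Let k ≥ 2 and let f : Fin(2k) → ℝ² be a WG-drawing with witness set P ⊆ ℝ² of a complete k-partite graph on vertex set Fin(2k) given by a class map c : Fin(2k) → Fin k, with every fiber of c of cardinality exactly 2 and adjacency of distinct vertices given by having different c-values. Assume the x-coordinates x(f(0)) < x(f(1)) < … < x(f(2k−1)) are strictly increasing in the index, every point of the image of f has strictly positive y-coordinate, and every point of P has strictly negative y-coordinate. Then for every index i < k we have c(i) = c(i + k), and moreover c(0), c(1), …, c(k−1) are pairwise distinct. -/

import Mathlib

noncomputable section

/-- The Euclidean plane. -/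
abbrev Pt : Type := EuclideanSpace ℝ (Fin 2)

/-- The Gabriel disk `D[u,v]`: the closed disk having `u` and `v` as antipodal points. -/
def gabrielDisk (u v : Pt) : Set Pt := Metric.closedBall (midpoint ℝ u v) (dist u v / 2)

/-- `f` is a witness Gabriel drawing of the finite simple graph `G` with witness set `P`. -/
def IsWGDrawing {V : Type*} [Fintype V] (G : SimpleGraph V) (f : V → Pt) (P : Set Pt) : Prop :=
  Function.Injective f ∧ Disjoint (Set.range f) P ∧
    ∀ u v : V, u ≠ v → (G.Adj u v ↔ gabrielDisk (f u) (f v) ∩ P = ∅)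

/-- `⟨f₀, f₁⟩` is a mutual witness Gabriel drawing of the pair `⟨G₀, G₁⟩`. -/
def IsMWGDrawing {V₀ V₁ : Type*} [Fintype V₀] [Fintype V₁]
    (G₀ : SimpleGraph V₀) (G₁ : SimpleGraph V₁) (f₀ : V₀ → Pt) (f₁ : V₁ → Pt) : Prop :=
  Function.Injective f₀ ∧ Function.Injective f₁ ∧
    Disjoint (Set.range f₀) (Set.range f₁) ∧
    (∀ u v : V₀, u ≠ v → (G₀.Adj u v ↔ gabrielDisk (f₀ u) (f₀ v) ∩ Set.range f₁ = ∅)) ∧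
    (∀ u v : V₁, u ≠ v → (G₁.Adj u v ↔ gabrielDisk (f₁ u) (f₁ v) ∩ Set.range f₀ = ∅))

/-- Two subsets of the plane are linearly separable. -/
def LinSep (A B : Set Pt) : Prop :=
  ∃ (φ : Pt →ₗ[ℝ] ℝ) (c : ℝ), φ ≠ 0 ∧ (∀ a ∈ A, φ a < c) ∧ ∀ b ∈ B, c < φ b

/-- The inner product of `a - p` and `b - p`, in coordinates. -/
def dotAt (p a b : Pt) : ℝ := (a 0 - p 0) * (b 0 - p 0) + (a 1 - p 1) * (b 1 - p 1)

/-- Twice the signed area of the triangle `p a b`. -/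
def crossAt (p a b : Pt) : ℝ := (a 0 - p 0) * (b 1 - p 1) - (a 1 - p 1) * (b 0 - p 0)

lemma dotAt_comm (p a b : Pt) : dotAt p a b = dotAt p b a := by
  unfold dotAt; ring

lemma mem_gabrielDisk_iff (u v p : Pt) : p ∈ gabrielDisk u v ↔ dotAt p u v ≤ 0 := by
  have key : dist p (midpoint ℝ u v) ^ 2 - (dist u v / 2) ^ 2 = dotAt p u v := by
    rw [div_pow, EuclideanSpace.dist_sq_eq, EuclideanSpace.dist_sq_eq]
    simp only [Fin.sum_univ_two, Real.dist_eq, sq_abs, midpoint_eq_smul_add, PiLp.smul_apply,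
      PiLp.add_apply, smul_eq_mul, invOf_eq_inv, dotAt]
    ring
  rw [gabrielDisk, Metric.mem_closedBall, ← sq_le_sq₀ dist_nonneg (by positivity), ← key,
    sub_nonpos]

/-- If `a` is left of `b` and both are above a point `p` of the Gabriel disk of `a` and `b`, then
`p` lies strictly between `a` and `b` horizontally. -/
lemma between_of_dotAt_nonpos {p a b : Pt} (ha : p 1 < a 1) (hb : p 1 < b 1) (hab : a 0 < b 0)
    (h : dotAt p a b ≤ 0) : a 0 < p 0 ∧ p 0 < b 0 := by
  have h1 := mul_pos (sub_pos.2 ha) (sub_pos.2 hb)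
  unfold dotAt at h
  constructor
  · by_contra! hc
    nlinarith [mul_nonneg (sub_nonneg.2 hc) (sub_nonneg.2 (hc.trans hab.le))]
  · by_contra! hc
    nlinarith [mul_nonneg (sub_nonneg.2 hc) (sub_nonneg.2 (hab.le.trans hc))]

/-- A point seen from `p` at acute angles from both `a` and `b`, where the angle `a p b` is not
acute, lies in the open wedge at `p` spanned by `a` and `b`. -/
lemma crossAt_neg_of_dotAt {p a b c : Pt} (ha : p 1 < a 1) (hb : p 1 < b 1) (hab : a 0 < b 0)
    (h : dotAt p a b ≤ 0) (hac : 0 < dotAt p a c) (hbc : 0 < dotAt p b c) :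
    crossAt p a c < 0 ∧ crossAt p c b < 0 := by
  obtain ⟨h1, h2⟩ := between_of_dotAt_nonpos ha hb hab h
  have hX : crossAt p a b < 0 := by
    unfold crossAt
    nlinarith [mul_pos (sub_pos.2 h1) (sub_pos.2 hb), mul_pos (sub_pos.2 ha) (sub_pos.2 h2)]
  have haa : 0 < dotAt p a a := by
    unfold dotAt
    nlinarith [mul_pos (sub_pos.2 h1) (sub_pos.2 h1), mul_pos (sub_pos.2 ha) (sub_pos.2 ha)]
  have hbb : 0 < dotAt p b b := by
    unfold dotAt
    nlinarith [mul_pos (sub_pos.2 h2) (sub_pos.2 h2), mul_pos (sub_pos.2 hb) (sub_pos.2 hb)]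
  have e1 : dotAt p a a * dotAt p b c
      = dotAt p a b * dotAt p a c + crossAt p a b * crossAt p a c := by
    unfold dotAt crossAt; ring
  have e2 : dotAt p b b * dotAt p a c
      = dotAt p a b * dotAt p b c + crossAt p a b * crossAt p c b := by
    unfold dotAt crossAt; ring
  constructor
  · by_contra! hc
    nlinarith [mul_pos haa hbc, mul_nonneg (neg_nonneg.2 h) hac.le,
      mul_nonneg (neg_nonneg.2 hX.le) hc]
  · by_contra! hc
    nlinarith [mul_pos hbb hac, mul_nonneg (neg_nonneg.2 h) hbc.le,
      mul_nonneg (neg_nonneg.2 hX.le) hc]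

/-- Two non-adjacent pairs of distinct classes cannot be horizontally separated. -/
lemma not_separated {a b c d p q : Pt} (hpa : p 1 < a 1) (hpb : p 1 < b 1)
    (hqc : q 1 < c 1) (hqd : q 1 < d 1)
    (hab : a 0 < b 0) (hbc : b 0 < c 0) (hcd : c 0 < d 0)
    (hp : dotAt p a b ≤ 0) (hq : dotAt q c d ≤ 0)
    (hpac : 0 < dotAt p a c) (hpbc : 0 < dotAt p b c)
    (hqcb : 0 < dotAt q c b) (hqdb : 0 < dotAt q d b) : False := by
  have h1 := (crossAt_neg_of_dotAt hpa hpb hab hp hpac hpbc).2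
  have h2 := (crossAt_neg_of_dotAt hqc hqd hcd hq hqcb hqdb).1
  have h3 := (between_of_dotAt_nonpos hpa hpb hab hp).2
  have h4 := (between_of_dotAt_nonpos hqc hqd hcd hq).1
  unfold crossAt at h1 h2
  have h5 : 0 < c 1 - b 1 := by
    by_contra! hc
    nlinarith [mul_pos (sub_pos.2 hpb) (sub_pos.2 hbc),
      mul_nonneg (sub_pos.2 h3).le (neg_nonneg.2 hc)]
  nlinarith [mul_pos (sub_pos.2 hqc) (sub_pos.2 hbc), mul_pos (sub_pos.2 h4) h5]

/-- If two vectors with positive coordinates in a basis `u`, `v` form a non-acute angle, then `u`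
and `v` form an obtuse angle. -/
lemma inner_neg_of_combination {D L α β M u0 u1 v0 v1 x0 x1 y0 y1 : ℝ}
    (hL : 0 < L) (hα : 0 < α) (hβ : 0 < β) (hM : 0 < M) (hu : 0 < u1)
    (hx0 : D * x0 = L * u0 + β * v0) (hx1 : D * x1 = L * u1 + β * v1)
    (hy0 : D * y0 = α * u0 + M * v0) (hy1 : D * y1 = α * u1 + M * v1)
    (h : x0 * y0 + x1 * y1 ≤ 0) : u0 * v0 + u1 * v1 < 0 := by
  have e : D ^ 2 * (x0 * y0 + x1 * y1)
      = L * α * (u0 ^ 2 + u1 ^ 2) + β * M * (v0 ^ 2 + v1 ^ 2)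
        + (L * M + α * β) * (u0 * v0 + u1 * v1) := by
    calc _ = (D * x0) * (D * y0) + (D * x1) * (D * y1) := by ring
      _ = _ := by rw [hx0, hx1, hy0, hy1]; ring
  have e1 := mul_nonpos_of_nonneg_of_nonpos (sq_nonneg D) h
  have e2 : 0 < L * α * (u0 ^ 2 + u1 ^ 2) := by positivity
  have e3 : 0 ≤ β * M * (v0 ^ 2 + v1 ^ 2) := by positivity
  have e4 : 0 < L * M + α * β := by positivity
  by_contra! hc
  linarith [mul_nonneg e4.le hc]

/-- If `u` and `v` form a non-acute angle, then so do vectors with coordinates of signs `(+, -)` and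
`(-, +)` in the basis `u`, `v`. -/
lemma inner_nonpos_of_combination {D l α β m u0 u1 v0 v1 x0 x1 y0 y1 : ℝ} (hD : 0 < D)
    (hl : 0 < l) (hα : 0 < α) (hβ : 0 < β) (hm : 0 < m)
    (hx0 : D * x0 = l * u0 - β * v0) (hx1 : D * x1 = l * u1 - β * v1)
    (hy0 : D * y0 = -α * u0 + m * v0) (hy1 : D * y1 = -α * u1 + m * v1)
    (h : u0 * v0 + u1 * v1 ≤ 0) : x0 * y0 + x1 * y1 ≤ 0 := by
  have e : D ^ 2 * (x0 * y0 + x1 * y1)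
      = -(l * α * (u0 ^ 2 + u1 ^ 2)) - β * m * (v0 ^ 2 + v1 ^ 2)
        + (l * m + α * β) * (u0 * v0 + u1 * v1) := by
    calc _ = (D * x0) * (D * y0) + (D * x1) * (D * y1) := by ring
      _ = _ := by rw [hx0, hx1, hy0, hy1]; ring
  have e2 : 0 ≤ l * α * (u0 ^ 2 + u1 ^ 2) := by positivity
  have e3 : 0 ≤ β * m * (v0 ^ 2 + v1 ^ 2) := by positivity
  have e4 : 0 ≤ l * m + α * β := by positivity
  have e5 := mul_nonpos_of_nonneg_of_nonpos e4 h
  by_contra! hc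
  linarith [mul_pos (pow_pos hD 2) hc]

/-- Two non-adjacent pairs of distinct classes cannot be horizontally nested. -/
lemma not_nested {a b c d p q : Pt} (hpa : p 1 < a 1) (hpb : p 1 < b 1)
    (hqa : q 1 < a 1) (hqc : q 1 < c 1) (hqd : q 1 < d 1)
    (hac : a 0 < c 0) (hcd : c 0 < d 0) (hdb : d 0 < b 0)
    (hp : dotAt p a b ≤ 0) (hq : dotAt q c d ≤ 0)
    (hpac : 0 < dotAt p a c) (hpbc : 0 < dotAt p b c)
    (hpad : 0 < dotAt p a d) (hpbd : 0 < dotAt p b d)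
    (hqac : 0 < dotAt q a c) (hqbc : 0 < dotAt q b c)
    (hqad : 0 < dotAt q a d) (hqbd : 0 < dotAt q b d) : False := by
  have hab := hac.trans (hcd.trans hdb)
  have k1 := (crossAt_neg_of_dotAt hpa hpb hab hp hpac hpbc).1
  have k2 := (crossAt_neg_of_dotAt hpa hpb hab hp hpad hpbd).2
  rw [dotAt_comm] at hqac hqbc hqbd
  have k3 := (crossAt_neg_of_dotAt hqc hqd hcd hq hqac (by rwa [dotAt_comm])).1
  have k4 := (crossAt_neg_of_dotAt hqc hqd hcd hq hqbc hqbd).2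
  obtain ⟨h1, h2⟩ := between_of_dotAt_nonpos hqc hqd hcd hq
  unfold crossAt at k1 k2 k3 k4
  unfold dotAt at hp hqad
  have hu1 : 0 < a 1 - c 1 := by
    by_contra! hc
    nlinarith [mul_pos (sub_pos.2 hac) (sub_pos.2 hqc),
      mul_nonneg (sub_pos.2 h1).le (neg_nonneg.2 hc)]
  have hv1 : 0 < b 1 - d 1 := by
    by_contra! hc
    nlinarith [mul_pos (sub_pos.2 hdb) (sub_pos.2 hqd),
      mul_nonneg (sub_pos.2 h2).le (neg_nonneg.2 hc)]
  obtain ⟨u0, hu0⟩ : ∃ t, t = a 0 - c 0 := ⟨_, rfl⟩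
  obtain ⟨u1, hu1'⟩ : ∃ t, t = a 1 - c 1 := ⟨_, rfl⟩
  obtain ⟨v0, hv0⟩ : ∃ t, t = b 0 - d 0 := ⟨_, rfl⟩
  obtain ⟨v1, hv1'⟩ : ∃ t, t = b 1 - d 1 := ⟨_, rfl⟩
  rw [← hu1'] at hu1
  rw [← hv1'] at hv1
  have hu0n : u0 < 0 := by linarith
  have hv0p : 0 < v0 := by linarith
  -- Coordinates in the basis `u = a - c`, `v = b - d`, scaled by its determinant `D`.
  obtain ⟨D, hD⟩ : ∃ t, t = v0 * u1 - v1 * u0 := ⟨_, rfl⟩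
  have hDpos : 0 < D := by nlinarith [mul_pos hv0p hu1, mul_pos hv1 (neg_pos.2 hu0n)]
  obtain ⟨β, hβ⟩ : ∃ t, t = (a 0 - p 0) * u1 - (a 1 - p 1) * u0 := ⟨_, rfl⟩
  obtain ⟨α, hα⟩ : ∃ t, t = v0 * (b 1 - p 1) - v1 * (b 0 - p 0) := ⟨_, rfl⟩
  obtain ⟨β', hβ'⟩ : ∃ t, t = -((a 0 - q 0) * u1 - (a 1 - q 1) * u0) := ⟨_, rfl⟩
  obtain ⟨α', hα'⟩ : ∃ t, t = -(v0 * (d 1 - q 1) - v1 * (d 0 - q 0)) := ⟨_, rfl⟩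
  obtain ⟨l, hl⟩ : ∃ t, t = v0 * (a 1 - q 1) - v1 * (a 0 - q 0) := ⟨_, rfl⟩
  obtain ⟨m, hm⟩ : ∃ t, t = (d 0 - q 0) * u1 - (d 1 - q 1) * u0 := ⟨_, rfl⟩
  have pβ : 0 < β := by rw [hβ, hu0, hu1']; linarith
  have pα : 0 < α := by rw [hα, hv0, hv1']; linarith
  have pβ' : 0 < β' := by rw [hβ', hu0, hu1']; linarith
  have pα' : 0 < α' := by rw [hα', hv0, hv1']; linarith
  have ea0 : D * (a 0 - q 0) = l * u0 - β' * v0 := by rw [hD, hl, hβ']; ring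
  have ea1 : D * (a 1 - q 1) = l * u1 - β' * v1 := by rw [hD, hl, hβ']; ring
  have ed0 : D * (d 0 - q 0) = -α' * u0 + m * v0 := by rw [hD, hm, hα']; ring
  have ed1 : D * (d 1 - q 1) = -α' * u1 + m * v1 := by rw [hD, hm, hα']; ring
  have pl : 0 < l := by
    have := mul_pos hDpos (sub_pos.2 hqa)
    have := mul_pos pβ' hv1
    exact pos_of_mul_pos_left (by linarith : 0 < l * u1) hu1.le
  have pm : 0 < m := by
    have := mul_pos hDpos (sub_pos.2 hqd)
    have := mul_pos pα' hu1
    exact pos_of_mul_pos_left (by linarith : 0 < m * v1) hv1.le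
  obtain ⟨L, hL⟩ : ∃ t, t = l + α + α' := ⟨_, rfl⟩
  obtain ⟨M, hM⟩ : ∃ t, t = m + D + β + β' := ⟨_, rfl⟩
  have pL : 0 < L := by linarith
  have pM : 0 < M := by linarith
  have eL : L = v0 * (a 1 - p 1) - v1 * (a 0 - p 0) := by
    rw [hL, hl, hα, hα', hv0, hv1']; ring
  have eM : M = (b 0 - p 0) * u1 - (b 1 - p 1) * u0 := by
    rw [hM, hm, hβ, hβ', hD, hv0, hv1']; ring
  have fa0 : D * (a 0 - p 0) = L * u0 + β * v0 := by rw [hD, eL, hβ]; ring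
  have fa1 : D * (a 1 - p 1) = L * u1 + β * v1 := by rw [hD, eL, hβ]; ring
  have fb0 : D * (b 0 - p 0) = α * u0 + M * v0 := by rw [hD, eM, hα]; ring
  have fb1 : D * (b 1 - p 1) = α * u1 + M * v1 := by rw [hD, eM, hα]; ring
  have huv := inner_neg_of_combination pL pα pβ pM hu1 fa0 fa1 fb0 fb1 hp
  exact hqad.not_ge
    (inner_nonpos_of_combination hDpos pl pα' pβ' pm ea0 ea1 ed0 ed1 huv.le)

/-- In a partition of `Fin (2 * k)` into pairs that pairwise interleave, the two elements of a
pair differ by `k`. -/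
lemma eq_add_of_pairwise_interleaved {k : ℕ} {σ : Fin (2 * k) → Fin (2 * k)}
    (hσ : Function.Involutive σ) (hne : ∀ a, σ a ≠ a)
    (hsep : ∀ a c, a < σ a → σ a < c → c < σ c → False)
    (hnest : ∀ a c, a < c → c < σ c → σ c < σ a → False)
    {a : Fin (2 * k)} (ha : a < σ a) : (σ a : ℕ) = a + k := by
  have hin : ∀ x ∈ Finset.Ioo a (σ a), σ x ∈ (Finset.Icc a (σ a))ᶜ := by
    intro x hx
    rw [Finset.mem_Ioo] at hx
    rw [Finset.mem_compl, Finset.mem_Icc]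
    rintro ⟨h1, h2⟩
    have n1 : σ x ≠ a := fun h => hx.2.ne (by rw [← h, hσ x])
    have n2 : σ x ≠ σ a := fun h => hx.1.ne' (hσ.injective h)
    have n3 := lt_of_le_of_ne h1 n1.symm
    have n4 := lt_of_le_of_ne h2 n2
    rcases lt_or_gt_of_ne (hne x) with h | h
    · exact hnest a (σ x) n3 (by rwa [hσ x]) (by rw [hσ x]; exact hx.2)
    · exact hnest a x hx.1 h n4
  have hout : ∀ x ∈ (Finset.Icc a (σ a))ᶜ, σ x ∈ Finset.Ioo a (σ a) := by
    intro x hx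
    rw [Finset.mem_compl, Finset.mem_Icc, not_and_or, not_le, not_le] at hx
    have n1 : σ x ≠ a := fun h => by
      rw [← h, hσ x] at hx ha
      exact hx.elim ha.not_gt (lt_irrefl _)
    have n2 : σ x ≠ σ a := fun h => by
      rw [hσ.injective h] at hx
      exact hx.elim (lt_irrefl _) ha.not_gt
    rw [Finset.mem_Ioo]
    by_contra hc
    rw [not_and_or, not_lt, not_lt] at hc
    have hc' := hc.imp (fun h => lt_of_le_of_ne h n1) (fun h => lt_of_le_of_ne h n2.symm)
    rcases hx with hx | hx <;> rcases hc' with hy | hy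
    · rcases lt_or_gt_of_ne (hne x) with h | h
      · exact hsep (σ x) a (by rwa [hσ x]) (by rwa [hσ x]) ha
      · exact hsep x a h hy ha
    · exact hnest x a hx ha hy
    · exact hnest (σ x) a hy ha (by rwa [hσ x])
    · rcases lt_or_gt_of_ne (hne x) with h | h
      · exact hsep a (σ x) ha hy (by rwa [hσ x])
      · exact hsep a x ha hx h
  have c1 := Finset.card_le_card_of_injOn σ hin hσ.injective.injOn
  have c2 := Finset.card_le_card_of_injOn σ hout hσ.injective.injOn
  rw [Finset.card_compl, Fin.card_Icc, Fin.card_Ioo, Fintype.card_fin] at c1 c2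
  have := (σ a).isLt
  have : (a : ℕ) < σ a := ha
  omega

/-- From Lemma 10: in a linearly separated WG-drawing of a complete `k`-partite graph
with all classes of size two and x-increasing vertex order, the `i`-th partition class
consists of vertices `i` and `i + k`. -/
theorem stmt17 (k : ℕ) (hk : 2 ≤ k)
    (G : SimpleGraph (Fin (2 * k))) (c : Fin (2 * k) → Fin k)
    (hfib : ∀ j : Fin k, Nat.card {v : Fin (2 * k) // c v = j} = 2)
    (hG : ∀ u v : Fin (2 * k), G.Adj u v ↔ c u ≠ c v)
    (f : Fin (2 * k) → Pt) (P : Set Pt) (hWG : IsWGDrawing G f P)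
    (hx : ∀ u v : Fin (2 * k), u < v → f u 0 < f v 0)
    (hy : ∀ v, 0 < f v 1) (hP : ∀ p ∈ P, p 1 < 0) :
    (∀ i : ℕ, (hi : i < k) → c ⟨i, by omega⟩ = c ⟨i + k, by omega⟩) ∧
      (∀ i j : ℕ, (hi : i < k) → (hj : j < k) → i ≠ j →
        c ⟨i, by omega⟩ ≠ c ⟨j, by omega⟩) := by
  obtain ⟨-, -, hadj⟩ := hWG
  have hpos : ∀ p ∈ P, ∀ v, p 1 < f v 1 := fun p hp v => (hP p hp).trans (hy v)
  have hwit : ∀ u v, u ≠ v → c u = c v → ∃ p ∈ P, dotAt p (f u) (f v) ≤ 0 := by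
    intro u v huv hc
    have h1 : ¬ gabrielDisk (f u) (f v) ∩ P = ∅ := by
      rw [← hadj u v huv, hG]
      exact not_not.2 hc
    obtain ⟨p, hp, hpP⟩ := Set.nonempty_iff_ne_empty.2 h1
    exact ⟨p, hpP, (mem_gabrielDisk_iff _ _ _).1 hp⟩
  have hacute : ∀ u v, c u ≠ c v → ∀ p ∈ P, 0 < dotAt p (f u) (f v) := by
    intro u v hc p hp
    have huv : u ≠ v := fun h => hc (congrArg c h)
    have h1 := (hadj u v huv).1 ((hG u v).2 hc)
    by_contra! h2
    exact Set.notMem_empty p (h1 ▸ ⟨(mem_gabrielDisk_iff _ _ _).2 h2, hp⟩)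
  have hpartner : ∀ v, ∃ w, (w ≠ v ∧ c w = c v) ∧ ∀ z, z ≠ v → c z = c v → z = w := by
    intro v
    obtain ⟨w, hw, huniq⟩ := (Nat.card_eq_two_iff' ⟨v, rfl⟩).1 (hfib (c v))
    exact ⟨w, ⟨fun h => hw (Subtype.ext h), w.2⟩, fun z hz hcz =>
      congrArg Subtype.val (huniq ⟨z, hcz⟩ fun h => hz (congrArg Subtype.val h))⟩
  choose σ hσ huniq using hpartner
  have hinv : Function.Involutive σ := fun v =>
    (huniq (σ v) v (hσ v).1.symm (hσ v).2.symm).symm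
  have hclass : ∀ a z, z ≠ a → z ≠ σ a → c z ≠ c a := fun a z h1 h2 h => h2 (huniq a z h1 h)
  have hclass' : ∀ a z, z ≠ a → z ≠ σ a → c z ≠ c (σ a) := fun a z h1 h2 => by
    rw [(hσ a).2]; exact hclass a z h1 h2
  have hsep : ∀ a d, a < σ a → σ a < d → d < σ d → False := by
    intro a d h1 h2 h3
    obtain ⟨p, hp, hpd⟩ := hwit a (σ a) h1.ne (hσ a).2.symm
    obtain ⟨q, hq, hqd⟩ := hwit d (σ d) h3.ne (hσ d).2.symm
    have n1 := hclass a d (h1.trans h2).ne' h2.ne'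
    have n2 := hclass' a d (h1.trans h2).ne' h2.ne'
    have n4 : c (σ d) ≠ c (σ a) := by rw [(hσ d).2]; exact n2
    exact not_separated (hpos p hp _) (hpos p hp _) (hpos q hq _) (hpos q hq _)
      (hx _ _ h1) (hx _ _ h2) (hx _ _ h3) hpd hqd (hacute _ _ n1.symm p hp)
      (hacute _ _ n2.symm p hp) (hacute _ _ n2 q hq) (hacute _ _ n4 q hq)
  have hnest : ∀ a d, a < d → d < σ d → σ d < σ a → False := by
    intro a d h1 h2 h3
    obtain ⟨p, hp, hpd⟩ := hwit a (σ a) (h1.trans (h2.trans h3)).ne (hσ a).2.symm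
    obtain ⟨q, hq, hqd⟩ := hwit d (σ d) h2.ne (hσ d).2.symm
    have n1 := (hclass a d h1.ne' (h2.trans h3).ne).symm
    have n2 := (hclass' a d h1.ne' (h2.trans h3).ne).symm
    have n3 : c a ≠ c (σ d) := by rw [(hσ d).2]; exact n1
    have n4 : c (σ a) ≠ c (σ d) := by rw [(hσ d).2]; exact n2
    exact not_nested (hpos p hp _) (hpos p hp _) (hpos q hq _) (hpos q hq _)
      (hpos q hq _) (hx _ _ h1) (hx _ _ h2) (hx _ _ h3) hpd hqd
      (hacute _ _ n1 p hp) (hacute _ _ n2 p hp) (hacute _ _ n3 p hp) (hacute _ _ n4 p hp)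
      (hacute _ _ n1 q hq) (hacute _ _ n2 q hq) (hacute _ _ n3 q hq) (hacute _ _ n4 q hq)
  have hgap : ∀ u v : Fin (2 * k), u < v → c u = c v → (v : ℕ) = u + k := by
    intro u v huv hc
    obtain rfl := huniq u v huv.ne' hc.symm
    exact eq_add_of_pairwise_interleaved hinv (fun a => (hσ a).1) hsep hnest huv
  constructor
  · intro i hi
    obtain ⟨w, hw⟩ : ∃ w, w = σ ⟨i, by omega⟩ := ⟨_, rfl⟩
    have h1 := hσ ⟨i, by omega⟩
    rw [← hw] at h1
    rw [← h1.2]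
    congr 1
    rcases lt_or_gt_of_ne h1.1 with h | h
    · have := hgap _ _ h h1.2
      simp only at this
      omega
    · exact Fin.ext (hgap _ _ h h1.2.symm)
  · intro i j hi hj hij hc
    rcases lt_or_gt_of_ne hij with h | h
    · have := hgap ⟨i, by omega⟩ ⟨j, by omega⟩ h hc
      simp only at this
      omega
    · have := hgap ⟨j, by omega⟩ ⟨i, by omega⟩ h hc.symm
      simp only at this
      omega
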